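/- arXiv:1310.7531 — 2 statements merged into one kernel-verified Lean document; each statement's English description precedes it below -/
import Mathlib

section
/- Let T₂(z) = ∑_{k≥1} k^{k-2} z^k/k! (a real power series convergent for |z| < 1/e), let (H_n)_{n≥1} be the polynomials defined by H₁(x) = 1 and H_{n+1}(x) = (2n−1+(n−1)x)·H_n(x) + (1+x)²·H_n′(x), and set H₀(x) = x(x+2)/(2(x+1)). Then there exists ε > 0 such that for all real x, u with |x| < ε and |u| < ε, the series ∑_{n≥0} (uⁿ/n!)·H_n(x) converges absolutely and equals (1+x) · T₂( ((u+x)/(1+x)) · e^{−x/(1+x)} ). -/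
open Polynomial

/-- `T₂(z) = ∑_{k≥1} k^{k-2} z^k / k!` (EGF of unrooted Cayley trees) as a function on `ℝ`. -/
noncomputable def treeT2fun (z : ℝ) : ℝ :=
  ∑' k : ℕ, if k = 0 then 0 else (k : ℝ) ^ (k - 2) * z ^ k / (Nat.factorial k)


noncomputable def tcoef (k : ℕ) : ℝ := if k = 0 then 0 else (k : ℝ) ^ (k - 2) / (Nat.factorial k)

lemma treeT2fun_eq (z : ℝ) : treeT2fun z = ∑' k : ℕ, tcoef k * z ^ k := by
  unfold treeT2fun tcoef
  congr 1; ext k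
  split_ifs <;> ring

lemma pow_self_bound (k : ℕ) : (k : ℝ) ^ k / (Nat.factorial k) ≤ 3 ^ k := by
  refine (Real.pow_div_factorial_le_exp (k : ℝ) (by positivity) k).trans ?_
  rw [← Real.exp_one_pow]
  exact pow_le_pow_left₀ (Real.exp_pos _).le (by linarith [Real.exp_one_lt_d9]) k

lemma tcoef_nonneg (k : ℕ) : 0 ≤ tcoef k := by
  unfold tcoef; split_ifs <;> positivity

lemma tcoef_mul_bound (k : ℕ) : k * tcoef k ≤ 3 ^ k := by
  refine le_trans ?_ (pow_self_bound k)
  unfold tcoef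
  split_ifs with h
  · simp [h]
  · rw [← mul_div_assoc]
    gcongr
    have h1 : (1 : ℝ) ≤ k := by exact_mod_cast Nat.one_le_iff_ne_zero.mpr h
    rw [← pow_succ']
    exact pow_le_pow_right₀ h1 (by omega)

lemma tcoef_bound (k : ℕ) : tcoef k ≤ 3 ^ k := by
  rcases Nat.eq_zero_or_pos k with h | h
  · simp [h, tcoef]
  · refine le_trans ?_ (tcoef_mul_bound k)
    have h1 : (1 : ℝ) ≤ k := by exact_mod_cast h
    nlinarith [tcoef_nonneg k]

lemma tcoef_succ (m : ℕ) : ((m + 1 : ℕ) : ℝ) * tcoef (m + 1)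
    = ((m : ℝ) + 1) ^ m / (Nat.factorial (m + 1)) := by
  unfold tcoef
  rw [if_neg (by omega)]
  rcases m with _ | m
  · simp
  · rw [show m + 1 + 1 - 2 = m by omega]
    push_cast; ring

lemma T2_fps : HasFPowerSeriesOnBall treeT2fun (FormalMultilinearSeries.ofScalars ℝ tcoef) 0
    (ENNReal.ofReal (1/4)) := by
  refine ⟨?_, by simp, ?_⟩
  · rw [ENNReal.ofReal]
    refine FormalMultilinearSeries.le_radius_of_summable _ ?_
    refine Summable.of_nonneg_of_le (fun n => by positivity) (fun n => ?_)
      (summable_geometric_of_lt_one (r := (3/4 : ℝ)) (by norm_num) (by norm_num))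
    rw [FormalMultilinearSeries.ofScalars_norm, Real.norm_of_nonneg (tcoef_nonneg n),
      Real.coe_toNNReal _ (by norm_num)]
    rw [show (3/4 : ℝ) = 3 * (1/4) by norm_num, mul_pow]
    gcongr
    exact tcoef_bound n
  · intro y hy
    rw [zero_add, treeT2fun_eq]
    simp only [FormalMultilinearSeries.ofScalars_apply_eq, smul_eq_mul]
    apply Summable.hasSum
    have hy' : |y| < 1/4 := by
      rw [Metric.mem_eball, edist_zero_right, ← ofReal_norm] at hy
      exact (ENNReal.ofReal_lt_ofReal_iff (by norm_num)).1 hy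
    refine Summable.of_norm_bounded
      (summable_geometric_of_lt_one (r := (3/4 : ℝ)) (by norm_num) (by norm_num)) (fun n => ?_)
    rw [norm_mul, norm_pow, Real.norm_of_nonneg (tcoef_nonneg n),
      show (3/4 : ℝ) = 3 * (1/4) by norm_num, mul_pow]
    gcongr
    · exact tcoef_bound n
    · exact hy'.le

lemma T2_hasDeriv {z : ℝ} (hz : |z| < 1/4) : HasDerivAt treeT2fun
    (∑' m : ℕ, ((m : ℝ) + 1) ^ m / (Nat.factorial (m + 1)) * z ^ m) z := by
  have key : ∀ n : ℕ, ∀ y : ℝ, |y| < 1/4 →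
      ‖tcoef n * (n * y ^ (n - 1))‖ ≤ 4 * (3/4 : ℝ) ^ n := by
    intro n y hy
    rcases n with _ | n
    · simp
    · rw [show tcoef (n+1) * (((n+1 : ℕ):ℝ) * y ^ (n + 1 - 1))
        = (((n+1 : ℕ):ℝ) * tcoef (n+1)) * y ^ n by simp; ring]
      have h0 : 0 ≤ ((n+1 : ℕ):ℝ) * tcoef (n+1) := mul_nonneg (by positivity) (tcoef_nonneg _)
      rw [norm_mul, norm_pow, Real.norm_of_nonneg h0]
      calc _ ≤ (3:ℝ) ^ (n+1) * (1/4) ^ n := by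
            gcongr
            · exact tcoef_mul_bound (n+1)
            · exact hy.le
        _ = _ := by rw [div_pow, div_pow]; field_simp; ring
  have hs : Summable fun n : ℕ => 4 * (3/4 : ℝ) ^ n :=
    (summable_geometric_of_lt_one (r := (3/4 : ℝ)) (by norm_num) (by norm_num)).mul_left 4
  have h := hasDerivAt_tsum_of_isPreconnected (𝕜 := ℝ) (g := fun n z => tcoef n * z ^ n)
    (g' := fun n z => tcoef n * (n * z ^ (n-1))) (t := Metric.ball (0:ℝ) (1/4)) (y₀ := 0) (y := z)
    hs Metric.isOpen_ball
    (convex_ball _ _).isPreconnected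
    (fun n y _ => (hasDerivAt_pow n y).const_mul _)
    (fun n y hy => key n y (by simpa using hy)) (by simp)
    (by
      apply summable_of_ne_finset_zero (s := {0})
      intro b hb
      have : b ≠ 0 := by simpa using hb
      simp [this]) (by simpa using hz)
  have e1 : treeT2fun = fun z => ∑' k : ℕ, tcoef k * z ^ k := funext treeT2fun_eq
  rw [e1]
  convert! h using 1
  rw [Summable.tsum_eq_zero_add (Summable.of_norm_bounded hs (fun n => key n z hz))]
  simp only [Nat.cast_zero, zero_mul, mul_zero, zero_add]
  congr 1; ext m
  rw [← tcoef_succ]; simp; ring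

lemma coef_zero (N : ℕ) : ∑ p ∈ Finset.HasAntidiagonal.antidiagonal N,
    ((p.1 : ℝ) + 1) ^ p.1 / (Nat.factorial (p.1 + 1)) * ((-((p.1:ℝ)+1)) ^ p.2 / Nat.factorial p.2)
     = if N = 0 then 1 else 0 := by
  split_ifs with h
  · subst h; simp
  rw [Finset.Nat.sum_antidiagonal_eq_sum_range_succ_mk]
  have h1 := congrFun (fwdDiff_iter_pow_eq_zero_of_lt (R := ℝ) (Nat.lt_succ_self N)) 0
  rw [fwdDiff_iter_eq_sum_shift, Finset.sum_range_succ'] at h1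
  simp [h] at h1
  have h2 : (((N+1).factorial : ℝ)) ≠ 0 := by positivity
  apply mul_left_cancel₀ h2
  rw [mul_zero, ← h1, Finset.mul_sum]
  apply Finset.sum_congr rfl
  intro k hk
  have hk' : k ≤ N := by simpa [Nat.lt_succ_iff] using hk
  obtain ⟨j, rfl⟩ := Nat.exists_eq_add_of_le hk'
  rw [Nat.cast_choose ℝ (by omega : k + 1 ≤ k + j + 1)]
  rw [show k + j + 1 - (k + 1) = j by omega, show k + j - k = j by omega, neg_pow, pow_add]
  have := Nat.factorial_ne_zero (k+1)
  have := Nat.factorial_ne_zero j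
  field_simp

lemma exp_bd {s : ℝ} (hs : |s| ≤ 1/19) : Real.exp |s| ≤ 19/18 := by
  have h1 := Real.one_sub_le_exp_neg |s|
  rw [Real.exp_neg] at h1
  have h2 : (18/19 : ℝ) ≤ (Real.exp |s|)⁻¹ := by linarith
  have := inv_anti₀ (by norm_num) h2
  simp at this; linarith

lemma T_inv {s : ℝ} (hs : |s| ≤ 1/19) :
    ∑' m : ℕ, ((m : ℝ) + 1) ^ m / (Nat.factorial (m + 1)) * (s * Real.exp (-s)) ^ m
      = Real.exp s := by
  set f : ℕ × ℕ → ℝ := fun p => ((p.1 : ℝ) + 1) ^ p.1 / (Nat.factorial (p.1 + 1)) * s ^ p.1 *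
    ((-((p.1:ℝ)+1) * s) ^ p.2 / Nat.factorial p.2) with hf
  have hexp : ∀ y : ℝ, HasSum (fun n : ℕ => y ^ n / Nat.factorial n) (Real.exp y) := by
    intro y
    rw [Real.exp_eq_exp_ℝ]
    exact NormedSpace.expSeries_div_hasSum_exp y
  have hE : Real.exp |s| ≤ 19/18 := exp_bd hs
  have hnorm : ∀ m j : ℕ, ‖f (m, j)‖ = ((m : ℝ) + 1) ^ m / (Nat.factorial (m + 1)) * |s| ^ m *
      ((((m:ℝ)+1) * |s|) ^ j / Nat.factorial j) := by
    intro m j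
    have : |(m:ℝ)+1| = m + 1 := abs_of_nonneg (by positivity)
    simp only [hf, Real.norm_eq_abs, abs_mul, abs_div, abs_pow, abs_neg, this, Nat.abs_cast]
  have hsum : Summable f := by
    rw [← summable_norm_iff, summable_prod_of_nonneg (fun _ => norm_nonneg _)]
    simp only [hnorm]
    refine ⟨fun m => ((hexp _).summable.mul_left _), ?_⟩
    simp only [tsum_mul_left, (hexp _).tsum_eq]
    refine Summable.of_nonneg_of_le (fun n => by positivity) (fun n => ?_)
      ((summable_geometric_of_lt_one (r := (1/6 : ℝ)) (by norm_num) (by norm_num)).mul_left (19/6))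
    have hb : ((n : ℝ) + 1) ^ n / (Nat.factorial (n + 1)) ≤ 3 ^ (n + 1) := by
      have := tcoef_mul_bound (n+1)
      rwa [tcoef_succ] at this
    have he : Real.exp (((n:ℝ) + 1) * |s|) = Real.exp |s| ^ (n+1) := by
      rw [← Real.exp_nat_mul]; push_cast; rfl
    rw [he]
    calc _ ≤ (3:ℝ) ^ (n+1) * (1/19) ^ n * (19/18) ^ (n+1) := by gcongr
      _ = (19/6) * (3 * (1/19) * (19/18)) ^ n := by rw [mul_pow, mul_pow]; ring
      _ = _ := by norm_num
  have h1 : ∑' p, f p = 1 := by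
    rw [← Finset.HasAntidiagonal.sigmaAntidiagonalEquivProd.tsum_eq f]
    have hsum' : Summable (fun c : (Σ n : ℕ, Finset.HasAntidiagonal.antidiagonal n) =>
        f (Finset.HasAntidiagonal.sigmaAntidiagonalEquivProd c)) :=
      Finset.HasAntidiagonal.sigmaAntidiagonalEquivProd.summable_iff.2 hsum
    rw [Summable.tsum_sigma' (fun n => (hasSum_fintype _).summable) hsum']
    have : ∀ N : ℕ, ∑' c : Finset.HasAntidiagonal.antidiagonal N,
        f (Finset.HasAntidiagonal.sigmaAntidiagonalEquivProd ⟨N, c⟩) = if N = 0 then 1 else 0 := by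
      intro N
      rw [tsum_fintype]
      simp only [Finset.HasAntidiagonal.sigmaAntidiagonalEquivProd_apply]
      rw [Finset.sum_coe_sort (Finset.HasAntidiagonal.antidiagonal N) f]
      have : ∀ p ∈ Finset.HasAntidiagonal.antidiagonal N, f p = s ^ N * (((p.1 : ℝ) + 1) ^ p.1 / (Nat.factorial (p.1 + 1)) * ((-((p.1:ℝ)+1)) ^ p.2 / Nat.factorial p.2)) := by
        intro p hp
        rw [← Finset.HasAntidiagonal.mem_antidiagonal.1 hp, hf]
        simp only [mul_pow, pow_add]
        ring
      rw [Finset.sum_congr rfl this, ← Finset.mul_sum, coef_zero]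
      split_ifs with h <;> simp [h]
    simp only [this]
    simp
  rw [hsum.tsum_prod] at h1
  simp only [hf, tsum_mul_left, (hexp _).tsum_eq] at h1
  have h2 : ∀ m : ℕ, ((m : ℝ) + 1) ^ m / (Nat.factorial (m + 1)) * s ^ m *
      Real.exp (-((m:ℝ)+1) * s) = Real.exp (-s) *
      (((m : ℝ) + 1) ^ m / (Nat.factorial (m + 1)) * (s * Real.exp (-s)) ^ m) := by
    intro m
    rw [show -((m:ℝ)+1) * s = m * (-s) + (-s) by ring, Real.exp_add, Real.exp_nat_mul, mul_pow]
    ring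
  simp only [h2, tsum_mul_left] at h1
  have h3 : Real.exp s * Real.exp (-s) = 1 := by rw [← Real.exp_add]; simp
  have h4 := congrArg (fun t => Real.exp s * t) h1
  simp only [← mul_assoc, h3] at h4
  simpa using h4

lemma z_bd {s : ℝ} (hs : |s| ≤ 1/19) : |s * Real.exp (-s)| ≤ 1/18 := by
  rw [abs_mul, abs_of_pos (Real.exp_pos _)]
  have h1 : Real.exp (-s) ≤ 19/18 :=
    (Real.exp_le_exp.2 (neg_le_abs s)).trans (exp_bd hs)
  calc |s| * Real.exp (-s) ≤ (1/19) * (19/18) := by gcongr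
    _ = _ := by norm_num

lemma T2_hasDeriv_s {s : ℝ} (hs : |s| ≤ 1/19) :
    HasDerivAt treeT2fun (Real.exp s) (s * Real.exp (-s)) := by
  have h := T2_hasDeriv (z := s * Real.exp (-s)) (by linarith [z_bd hs])
  rwa [T_inv hs] at h

lemma hasDeriv_z (s : ℝ) : HasDerivAt (fun s : ℝ => s * Real.exp (-s))
    ((1 - s) * Real.exp (-s)) s := by
  have h := (hasDerivAt_id s).mul ((hasDerivAt_neg s).exp)
  convert! h using 1
  simp; ring

lemma T2_val {s : ℝ} (hs : |s| < 1/19) : treeT2fun (s * Real.exp (-s)) = s - s ^ 2 / 2 := by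
  have hd : ∀ y ∈ Metric.ball (0:ℝ) (1/19), HasDerivAt
      (fun s => treeT2fun (s * Real.exp (-s)) - (s - s ^ 2 / 2)) 0 y := by
    intro y hy
    have hy' : |y| ≤ 1/19 := by
      have : |y| < 1/19 := by simpa using hy
      exact this.le
    have h1 := HasDerivAt.comp y (T2_hasDeriv_s hy') (hasDeriv_z y)
    have h2 := h1.sub ((hasDerivAt_id y).sub ((hasDerivAt_pow 2 y).div_const 2))
    convert! h2 using 1
    rw [Real.exp_neg]
    have := Real.exp_pos y
    field_simp
    simp
    ring
  have h := IsOpen.is_const_of_deriv_eq_zero (𝕜 := ℝ) Metric.isOpen_ball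
    (convex_ball (0:ℝ) (1/19)).isPreconnected
    (fun y hy => (hd y hy).differentiableAt.differentiableWithinAt)
    (fun y hy => (hd y hy).deriv) (x := s) (y := 0) (by simpa using hs) (by simp)
  have h0 : treeT2fun 0 = 0 := by
    rw [treeT2fun_eq]
    apply (tsum_congr _).trans tsum_zero
    intro k
    rcases k with _ | k <;> simp [tcoef]
  simp [h0] at h
  linarith

lemma T2_analytic {z : ℝ} (hz : |z| < 1/4) : AnalyticAt ℝ treeT2fun z := by
  refine T2_fps.analyticAt_of_mem ?_
  rw [Metric.mem_eball, edist_zero_right, ← ofReal_norm]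
  exact (ENNReal.ofReal_lt_ofReal_iff (by norm_num)).2 hz

lemma T2_taylor {z h : ℝ} (hz : |z| ≤ 1/18) (hh : |h| ≤ 1/18) :
    HasSum (fun n : ℕ => h ^ n / Nat.factorial n * iteratedDeriv n treeT2fun z)
      (treeT2fun (z + h)) := by
  have hlt : (‖z‖₊ : ENNReal) < ENNReal.ofReal (1/4) := by
    rw [← enorm_eq_nnnorm, ← ofReal_norm]
    refine (ENNReal.ofReal_lt_ofReal_iff (by norm_num)).2 ?_
    rw [Real.norm_eq_abs]; linarith
  have h1 := T2_fps.changeOrigin hlt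
  rw [zero_add] at h1
  have h2 := h1.hasSum_iteratedFDeriv (y := h) (by
    rw [Metric.mem_eball, edist_zero_right, ← ofReal_norm, ← enorm_eq_nnnorm, ← ofReal_norm,
      ← ENNReal.ofReal_sub _ (norm_nonneg _), Real.norm_eq_abs, Real.norm_eq_abs]
    exact (ENNReal.ofReal_lt_ofReal_iff (by linarith)).2 (by linarith))
  convert! h2 using 2 with n
  rw [iteratedFDeriv_apply_eq_iteratedDeriv_mul_prod]
  simp; ring

noncomputable def KK (n : ℕ) (x : ℝ) : ℝ :=
  (1 + x) * (Real.exp (-(x / (1 + x))) / (1 + x)) ^ n *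
    iteratedDeriv n treeT2fun (x / (1 + x) * Real.exp (-(x / (1 + x))))

lemma s_bd {x : ℝ} (hx : |x| < 1/20) : |x / (1 + x)| < 1/19 := by
  have h := abs_lt.1 hx
  have hp : 0 < 1 + x := by linarith
  rw [abs_div, abs_of_pos hp, div_lt_iff₀ hp]
  linarith

lemma hasDeriv_s {x : ℝ} (hp : 1 + x ≠ 0) :
    HasDerivAt (fun x : ℝ => x / (1 + x)) (1 / (1 + x) ^ 2) x := by
  have h := (hasDerivAt_id x).div ((hasDerivAt_id x).const_add 1) hp
  convert! h using 1
  simp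

lemma KK_deriv (n : ℕ) {x : ℝ} (hx : |x| < 1/20) :
    HasDerivAt (KK n) ((KK (n+1) x - (2 * n - 1 + (n - 1) * x) * KK n x) / (1 + x) ^ 2) x := by
  have h := abs_lt.1 hx
  have hp : 1 + x ≠ 0 := by intro h0; linarith
  have hs := s_bd hx
  have hds := hasDeriv_s hp
  have hz := (hasDeriv_z (x / (1 + x))).comp x hds
  have hT : HasDerivAt (iteratedDeriv n treeT2fun)
      (iteratedDeriv (n+1) treeT2fun (x / (1 + x) * Real.exp (-(x / (1 + x)))))
      (x / (1 + x) * Real.exp (-(x / (1 + x)))) := by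
    rw [iteratedDeriv_succ]
    apply DifferentiableAt.hasDerivAt
    rw [iteratedDeriv_eq_iterate]
    exact ((T2_analytic (by linarith [z_bd hs.le])).iterated_deriv n).differentiableAt
  have hTz := HasDerivAt.comp x hT hz
  have he := (hds.neg.exp).div ((hasDerivAt_id x).const_add 1) hp
  have hpow := (((hasDerivAt_id x).const_add 1).mul (he.pow n)).mul hTz
  convert! hpow using 1
  simp only [KK, Function.comp, id, Pi.pow_apply, Pi.div_apply, Pi.neg_apply, Pi.mul_apply]
  generalize iteratedDeriv (n+1) treeT2fun _ = A
  generalize iteratedDeriv n treeT2fun _ = B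
  generalize Real.exp _ = E
  rcases n with _ | n
  · simp
    field_simp
    ring
  · simp only [Nat.add_sub_cancel, pow_succ]
    generalize (E / (1 + x)) ^ n = P
    push_cast
    field_simp
    ring

lemma KK_eq (H : ℕ → Polynomial ℚ) (hH1 : H 1 = 1)
    (hHrec : ∀ n : ℕ, 1 ≤ n → H (n + 1) =
      (Polynomial.C (2 * (n : ℚ) - 1) + Polynomial.C ((n : ℚ) - 1) * Polynomial.X) * H n
        + (1 + Polynomial.X) ^ 2 * Polynomial.derivative (H n)) (n : ℕ) (hn : 1 ≤ n) :
    ∀ x : ℝ, |x| < 1/20 → KK n x = Polynomial.aeval x (H n) := by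
  induction n, hn using Nat.le_induction with
  | base =>
    intro x hx
    have h := abs_lt.1 hx
    have hp : 1 + x ≠ 0 := by intro h0; linarith
    rw [hH1, KK, iteratedDeriv_one, (T2_hasDeriv_s (s_bd hx).le).deriv, Real.exp_neg]
    have := Real.exp_pos (x / (1 + x))
    simp
    field_simp
  | succ n hn ih =>
    intro x hx
    have h := abs_lt.1 hx
    have hp : 1 + x ≠ 0 := by intro h0; linarith
    have h1 := KK_deriv n hx
    have h2 : HasDerivAt (KK n) (Polynomial.aeval x (derivative (H n))) x := by
      refine (Polynomial.hasDerivAt_aeval (H n) x).congr_of_eventuallyEq ?_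
      have : Metric.ball (0:ℝ) (1/20) ∈ nhds x :=
        Metric.isOpen_ball.mem_nhds (by simpa using hx)
      filter_upwards [this] with y hy
      exact ih y (by simpa using hy)
    have h3 := h1.unique h2
    rw [div_eq_iff (by positivity)] at h3
    rw [hHrec n hn]
    simp only [map_add, map_mul, map_pow, aeval_C, aeval_X, map_one, ← ih x hx]
    simp
    linarith

theorem stmt_8 (H : ℕ → Polynomial ℚ) (hH1 : H 1 = 1)
    (hHrec : ∀ n : ℕ, 1 ≤ n → H (n + 1) =
      (Polynomial.C (2 * (n : ℚ) - 1) + Polynomial.C ((n : ℚ) - 1) * Polynomial.X) * H n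
        + (1 + Polynomial.X) ^ 2 * Polynomial.derivative (H n)) :
    ∃ ε > (0 : ℝ), ∀ x u : ℝ, |x| < ε → |u| < ε →
      (Summable fun n : ℕ =>
        |u ^ n / (Nat.factorial n) *
          (if n = 0 then x * (x + 2) / (2 * (x + 1)) else Polynomial.aeval x (H n))|) ∧
      (∑' n : ℕ, u ^ n / (Nat.factorial n) *
          (if n = 0 then x * (x + 2) / (2 * (x + 1)) else Polynomial.aeval x (H n)))
        = (1 + x) * treeT2fun (((u + x) / (1 + x)) * Real.exp (-x / (1 + x))) := by
  refine ⟨1/20, by norm_num, ?_⟩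
  intro x u hx hu
  have h := abs_lt.1 hx
  have hp : 0 < 1 + x := by linarith
  have hs := s_bd hx
  have hK : ∀ n : ℕ, (if n = 0 then x * (x + 2) / (2 * (x + 1)) else Polynomial.aeval x (H n))
      = KK n x := by
    intro n
    split_ifs with hn
    · subst hn
      rw [KK, iteratedDeriv_zero, T2_val hs, add_comm x 1]
      field_simp
      ring
    · exact (KK_eq H hH1 hHrec n (by omega) x hx).symm
  simp only [hK]
  have hE : Real.exp (-(x / (1 + x))) ≤ 19/18 :=
    (Real.exp_le_exp.2 (neg_le_abs _)).trans (exp_bd hs.le)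
  have hh : |u * (Real.exp (-(x / (1 + x))) / (1 + x))| ≤ 1/18 := by
    rw [abs_mul, abs_of_pos (div_pos (Real.exp_pos _) hp)]
    calc _ ≤ (1/20 : ℝ) * ((19/18) / (19/20)) := by
          gcongr
          linarith
      _ = _ := by norm_num
  have hT := (T2_taylor (z_bd hs.le) hh).mul_left (1 + x)
  have hS : HasSum (fun n : ℕ => u ^ n / (Nat.factorial n) * KK n x)
      ((1 + x) * treeT2fun (((u + x) / (1 + x)) * Real.exp (-x / (1 + x)))) := by
    convert! hT using 2 with n
    · rw [KK, mul_pow]; ring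
    · congr 1
      rw [neg_div]; ring
  exact ⟨summable_abs_iff.2 hS.summable, hS.tsum_eq⟩
end

section
/- Let W : ℝ → ℝ be a function satisfying W(z)·e^{W(z)} = z for all z > 0, and define f(z) = (1/2)·W(z)² + W(z). Then f(z) > 0 for all z > 0, f is infinitely differentiable on (0,∞), and for every n ≥ 1 and every z > 0, (−1)^{n−1} times the n-th derivative of f (taken within (0,∞)) at z is nonnegative. In other words, (1/2)W² + W (which equals −T₂(−z), where T₂ is the exponential generating function of unrooted Cayley trees) is a Bernstein function. -/
lemma aux_pos (W : ℝ → ℝ) (hW : ∀ z : ℝ, 0 < z → W z * Real.exp (W z) = z) (z : ℝ) (hz : 0 < z) :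
    0 < W z := by
  have h := hW z hz
  by_contra hn
  have := mul_nonpos_of_nonpos_of_nonneg (not_lt.mp hn) (Real.exp_pos (W z)).le
  linarith

lemma aux_cont (W : ℝ → ℝ) (hW : ∀ z : ℝ, 0 < z → W z * Real.exp (W z) = z) :
    ContinuousOn W (Set.Ioi 0) := by
  have : LipschitzOnWith 1 W (Set.Ioi 0) := by
    apply LipschitzOnWith.of_le_add
    intro a ha b hb
    have h1 := hW a ha
    have h2 := hW b hb
    have p1 := aux_pos W hW a ha
    have p2 := aux_pos W hW b hb
    have hd : a - b ≤ dist a b := by rw [Real.dist_eq]; exact le_abs_self _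
    rcases le_total (W a) (W b) with h | h
    · have : 0 ≤ dist a b := dist_nonneg
      linarith
    · have e1 : Real.exp (W b) ≤ Real.exp (W a) := Real.exp_le_exp.mpr h
      have e2 : 1 ≤ Real.exp (W b) := Real.one_le_exp p2.le
      have e3 : 1 ≤ Real.exp (W a) := e2.trans e1
      have k1 : W b * Real.exp (W b) ≤ W b * Real.exp (W a) := by gcongr
      have k2 : W a - W b ≤ (W a - W b) * Real.exp (W a) :=
        le_mul_of_one_le_right (by linarith) e3
      linarith
  exact this.continuousOn

lemma aux_deriv (W : ℝ → ℝ) (hW : ∀ z : ℝ, 0 < z → W z * Real.exp (W z) = z) (z : ℝ) (hz : 0 < z) :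
    HasDerivAt W (Real.exp (-W z) * (1 + W z)⁻¹) z := by
  have hp := aux_pos W hW z hz
  have h : HasDerivAt (fun x : ℝ => x * Real.exp x) (Real.exp (W z) * (1 + W z)) (W z) := by
    have := (hasDerivAt_id (W z)).mul (Real.hasDerivAt_exp (W z))
    refine HasDerivAt.congr_deriv this ?_
    simp; ring
  have := HasDerivAt.of_local_left_inverse
    ((aux_cont W hW).continuousAt (Ioi_mem_nhds hz)) h (by positivity)
    (Filter.eventually_of_mem (Ioi_mem_nhds hz) hW)
  rwa [mul_inv, ← Real.exp_neg] at this

lemma aux_smooth (W : ℝ → ℝ) (hW : ∀ z : ℝ, 0 < z → W z * Real.exp (W z) = z) :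
    ContDiffOn ℝ (⊤ : ℕ∞) W (Set.Ioi 0) := by
  rw [contDiffOn_infty]
  intro n
  induction n with
  | zero => exact contDiffOn_zero.mpr (aux_cont W hW)
  | succ n ih =>
    push_cast
    rw [contDiffOn_succ_iff_deriv_of_isOpen isOpen_Ioi]
    refine ⟨fun z hz => (aux_deriv W hW z hz).differentiableAt.differentiableWithinAt, by simp, ?_⟩
    have : ContDiffOn ℝ n (fun z => Real.exp (-W z) * (1 + W z)⁻¹) (Set.Ioi 0) := by
      refine ih.neg.exp.mul ((contDiffOn_const.add ih).inv ?_)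
      intro z hz
      have := aux_pos W hW z hz
      positivity
    exact this.congr fun z hz => (aux_deriv W hW z hz).deriv

lemma aux_mono (W : ℝ → ℝ) (hW : ∀ z : ℝ, 0 < z → W z * Real.exp (W z) = z) (n : ℕ) :
    ∀ (a b : ℕ) (z : ℝ), 0 < z → 0 ≤ (-1 : ℝ) ^ n *
      iteratedDerivWithin n (fun z => Real.exp (-W z) ^ a * (1 + W z)⁻¹ ^ b) (Set.Ioi 0) z := by
  have hs : ∀ a b : ℕ, ContDiffOn ℝ (⊤ : ℕ∞)
      (fun z => Real.exp (-W z) ^ a * (1 + W z)⁻¹ ^ b) (Set.Ioi 0) := by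
    intro a b
    have ih := aux_smooth W hW
    refine (ih.neg.exp.pow a).mul (((contDiffOn_const.add ih).inv ?_).pow b)
    intro z hz
    have := aux_pos W hW z hz
    positivity
  induction n with
  | zero =>
    intro a b z hz
    have := aux_pos W hW z hz
    simp only [pow_zero, one_mul, iteratedDerivWithin_zero]
    positivity
  | succ n ih =>
    intro a b z hz
    have hd : Set.EqOn (derivWithin (fun z => Real.exp (-W z) ^ a * (1 + W z)⁻¹ ^ b) (Set.Ioi 0))
      (fun z => (-a : ℝ) * (Real.exp (-W z) ^ (a+1) * (1 + W z)⁻¹ ^ (b+1)) +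
        (-b : ℝ) * (Real.exp (-W z) ^ (a+1) * (1 + W z)⁻¹ ^ (b+2))) (Set.Ioi 0) := by
      intro z hz
      have hp := aux_pos W hW z hz
      have h := aux_deriv W hW z hz
      rw [derivWithin_of_isOpen isOpen_Ioi hz]
      have h1 := (h.neg.exp.pow a).mul (((h.const_add 1).inv (by positivity)).pow b)
      refine (HasDerivAt.deriv h1).trans ?_
      simp only [Pi.neg_apply, Pi.inv_apply, Pi.pow_apply]
      generalize Real.exp (-W z) = g
      have hu : 1 + W z ≠ 0 := by positivity
      rcases a with _ | a <;> rcases b with _ | b <;> simp <;> field_simp <;> ring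
    rw [iteratedDerivWithin_succ', iteratedDerivWithin_congr hd hz]
    have hz' : z ∈ Set.Ioi (0:ℝ) := hz
    have hu : UniqueDiffOn ℝ (Set.Ioi (0:ℝ)) := isOpen_Ioi.uniqueDiffOn
    have hc : ∀ a b : ℕ, ContDiffWithinAt ℝ n
      (fun z => Real.exp (-W z) ^ a * (1 + W z)⁻¹ ^ b) (Set.Ioi 0) z := fun a b =>
        ((hs a b).of_le (by exact_mod_cast le_top)) z hz
    rw [iteratedDerivWithin_fun_add hz' hu (contDiffWithinAt_const.mul (hc _ _))
      (contDiffWithinAt_const.mul (hc _ _)),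
      iteratedDerivWithin_const_mul hz' hu _ (hc _ _),
      iteratedDerivWithin_const_mul hz' hu _ (hc _ _)]
    have i1 := mul_nonneg (Nat.cast_nonneg (α := ℝ) a) (ih (a+1) (b+1) z hz)
    have i2 := mul_nonneg (Nat.cast_nonneg (α := ℝ) b) (ih (a+1) (b+2) z hz)
    rw [pow_succ]
    linarith

/-- If `W` is the Lambert W function on `(0,∞)`, then `f = (1/2)·W² + W`
(= `−T₂(−z)`, `T₂` being the EGF of unrooted Cayley trees) is a Bernstein function. -/
theorem stmt_14 (W : ℝ → ℝ) (hW : ∀ z : ℝ, 0 < z → W z * Real.exp (W z) = z) :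
    (∀ z : ℝ, 0 < z → 0 < (1 / 2) * (W z) ^ 2 + W z) ∧
    ContDiffOn ℝ (⊤ : ℕ∞) (fun z => (1 / 2) * (W z) ^ 2 + W z) (Set.Ioi 0) ∧
    (∀ n : ℕ, 1 ≤ n → ∀ z : ℝ, 0 < z →
      0 ≤ (-1 : ℝ) ^ (n - 1) *
        iteratedDerivWithin n (fun z => (1 / 2) * (W z) ^ 2 + W z) (Set.Ioi 0) z) := by
  refine ⟨fun z hz => ?_, ?_, ?_⟩
  · have := aux_pos W hW z hz
    positivity
  · have := aux_smooth W hW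
    exact (contDiffOn_const.mul (this.pow 2)).add this
  · intro n hn z hz
    obtain ⟨n, rfl⟩ : ∃ m, n = m + 1 := ⟨n - 1, by omega⟩
    have hd : Set.EqOn (derivWithin (fun z => (1 / 2) * (W z) ^ 2 + W z) (Set.Ioi 0))
      (fun z => Real.exp (-W z) ^ 1 * (1 + W z)⁻¹ ^ 0) (Set.Ioi 0) := by
      intro z hz
      have hp := aux_pos W hW z hz
      have h := aux_deriv W hW z hz
      rw [derivWithin_of_isOpen isOpen_Ioi hz]
      refine (HasDerivAt.deriv (((h.pow 2).const_mul (1/2)).add h)).trans ?_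
      have hu : 1 + W z ≠ 0 := by positivity
      simp
      field_simp
      ring
    rw [iteratedDerivWithin_succ', iteratedDerivWithin_congr hd hz]
    simpa only [Nat.add_sub_cancel] using aux_mono W hW n 1 0 z hz
end
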